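/- Let g = sl₂(ℂ) with standard basis e, f, h, let g̃ = ℂ[t,t⁻¹] ⊗ g be its loop algebra, and write x_r = ι(t^r ⊗ x) ∈ U(g̃). Let λ be a nonnegative integer, let a_1, …, a_λ be nonzero complex numbers, and for s ∈ ℤ set ω_s = a_1^s + ⋯ + a_λ^s. Let I be the left ideal of U(g̃) generated by the elements e_r (r ∈ ℤ), h_s − ω_s·1 (s ∈ ℤ), and (f_r)^{λ+1} (r ∈ ℤ). Then the quotient U(g̃)/I is a finite-dimensional complex vector space. -/

import Mathlib

set_option synthInstance.maxHeartbeats 1000000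
set_option maxHeartbeats 1000000

open scoped TensorProduct
open LaurentPolynomial LieAlgebra.SpecialLinear

/-- `e` in the standard basis of `sl₂`. -/
noncomputable def Esl2 : sl (Fin 2) ℂ :=
  ⟨!![0,1;0,0], show _ ∈ LinearMap.ker (Matrix.traceLinearMap (Fin 2) ℂ ℂ) by
    simp [LinearMap.mem_ker, Matrix.trace_fin_two]⟩

/-- `f` in the standard basis of `sl₂`. -/
noncomputable def Fsl2 : sl (Fin 2) ℂ :=
  ⟨!![0,0;1,0], show _ ∈ LinearMap.ker (Matrix.traceLinearMap (Fin 2) ℂ ℂ) by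
    simp [LinearMap.mem_ker, Matrix.trace_fin_two]⟩

/-- `h` in the standard basis of `sl₂`. -/
noncomputable def Hsl2 : sl (Fin 2) ℂ :=
  ⟨!![1,0;0,-1], show _ ∈ LinearMap.ker (Matrix.traceLinearMap (Fin 2) ℂ ℂ) by
    simp [LinearMap.mem_ker, Matrix.trace_fin_two]⟩

/-- The loop algebra `g̃ = ℂ[t,t⁻¹] ⊗ sl₂(ℂ)`. -/
abbrev loopSl2 := ℂ[T;T⁻¹] ⊗[ℂ] (sl (Fin 2) ℂ)

/-- The loop algebra is a Lie algebra over `ℂ`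
(by restriction of scalars from `ℂ[t,t⁻¹]`). -/
noncomputable instance : LieAlgebra ℂ loopSl2 where
  lie_smul t x y := by
    rw [← algebraMap_smul ℂ[T;T⁻¹] t y,
      lie_smul (algebraMap ℂ ℂ[T;T⁻¹] t) x y, algebraMap_smul]

/-- The universal enveloping algebra `U(g̃)`. -/
abbrev Ug : Type := UniversalEnvelopingAlgebra ℂ loopSl2

/-- `e_r = ι(tʳ ⊗ e) ∈ U(g̃)`. -/
noncomputable def Eel (r : ℤ) : Ug :=
  UniversalEnvelopingAlgebra.ι ℂ ((T r : ℂ[T;T⁻¹]) ⊗ₜ[ℂ] Esl2)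

/-- `f_r = ι(tʳ ⊗ f) ∈ U(g̃)`. -/
noncomputable def Fel (r : ℤ) : Ug :=
  UniversalEnvelopingAlgebra.ι ℂ ((T r : ℂ[T;T⁻¹]) ⊗ₜ[ℂ] Fsl2)

/-- `h_r = ι(tʳ ⊗ h) ∈ U(g̃)`. -/
noncomputable def Hel (r : ℤ) : Ug :=
  UniversalEnvelopingAlgebra.ι ℂ ((T r : ℂ[T;T⁻¹]) ⊗ₜ[ℂ] Hsl2)

/-- The defining left ideal of the Weyl module `W(ω)` attached to the Drinfeld
polynomial `ω(u) = ∏ⱼ (1 − aⱼu)`: it is generated by the `e_r`, the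
`h_s − ω_s·1` where `ω_s = ∑ⱼ aⱼˢ`, and the `f_r^{λ+1}`. -/
noncomputable def weylIdeal (lam : ℕ) (a : Fin lam → ℂ) : Ideal Ug :=
  Ideal.span ({x : Ug | ∃ r : ℤ, x = Eel r} ∪
    {x : Ug | ∃ s : ℤ, x = Hel s - algebraMap ℂ Ug (∑ j, a j ^ s)} ∪
    {x : Ug | ∃ r : ℤ, x = Fel r ^ (lam + 1)})

/-- Three families of operators satisfying the relations of a highest weight representation of
the loop algebra of `sl₂`, with a cyclic highest weight vector on which every lowering operator
`f (T r)` is nilpotent of order at most `n + 1`. -/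
structure LoopHighestWeight (M : Type*) [AddCommGroup M] [Module ℂ M] (n : ℕ) where
  e : ℂ[T;T⁻¹] →ₗ[ℂ] Module.End ℂ M
  f : ℂ[T;T⁻¹] →ₗ[ℂ] Module.End ℂ M
  h : ℂ[T;T⁻¹] →ₗ[ℂ] Module.End ℂ M
  w : M
  e_f : ∀ p q v, e p (f q v) = f q (e p v) + h (p * q) v
  h_f : ∀ p q v, h p (f q v) = f q (h p v) - (2 : ℂ) • f (p * q) v
  f_f : ∀ p q v, f p (f q v) = f q (f p v)
  e_w : ∀ p, e p w = 0
  h_w : ∀ p, ∃ c : ℂ, h p w = c • w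
  f_w : ∀ r : ℤ, (f (T r) ^ (n + 1)) w = 0
  cyclic : ∀ X : Submodule ℂ M, w ∈ X → (∀ p, ∀ v ∈ X, e p v ∈ X) → (∀ p, ∀ v ∈ X, f p v ∈ X) →
    (∀ p, ∀ v ∈ X, h p v ∈ X) → X = ⊤

namespace LoopHighestWeight

variable {M : Type*} [AddCommGroup M] [Module ℂ M] {n : ℕ} (D : LoopHighestWeight M n)

/-- The smallest subspace containing the highest weight vector and stable under the lowering
operators. -/
def lowered : Submodule ℂ M :=
  sInf {X | D.w ∈ X ∧ ∀ p, ∀ v ∈ X, D.f p v ∈ X}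

lemma w_mem_lowered : D.w ∈ D.lowered :=
  Submodule.mem_sInf.2 fun _ hX => hX.1

lemma f_mem_lowered (p : ℂ[T;T⁻¹]) {v : M} (hv : v ∈ D.lowered) : D.f p v ∈ D.lowered :=
  Submodule.mem_sInf.2 fun X hX => hX.2 p v (Submodule.mem_sInf.1 hv X hX)

lemma lowered_le {X : Submodule ℂ M} (hw : D.w ∈ X) (hf : ∀ p, ∀ v ∈ X, D.f p v ∈ X) :
    D.lowered ≤ X :=
  sInf_le ⟨hw, hf⟩

lemma h_mem_lowered (p : ℂ[T;T⁻¹]) {v : M} (hv : v ∈ D.lowered) : D.h p v ∈ D.lowered := by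
  suffices H : D.lowered ≤ D.lowered ⊓ ⨅ q, D.lowered.comap (D.h q) by
    exact (Submodule.mem_iInf _).1 (H hv).2 p
  refine D.lowered_le ⟨D.w_mem_lowered, (Submodule.mem_iInf _).2 fun q => ?_⟩ ?_
  · obtain ⟨c, hc⟩ := D.h_w q
    simpa [hc] using D.lowered.smul_mem c D.w_mem_lowered
  · rintro q v ⟨hv, hh⟩
    refine ⟨D.f_mem_lowered q hv, (Submodule.mem_iInf _).2 fun s => ?_⟩
    rw [Submodule.mem_comap, D.h_f]
    exact sub_mem (D.f_mem_lowered _ ((Submodule.mem_iInf _).1 hh s))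
      (D.lowered.smul_mem _ (D.f_mem_lowered _ hv))

lemma e_mem_lowered (p : ℂ[T;T⁻¹]) {v : M} (hv : v ∈ D.lowered) : D.e p v ∈ D.lowered := by
  suffices H : D.lowered ≤ D.lowered ⊓ ⨅ q, D.lowered.comap (D.e q) by
    exact (Submodule.mem_iInf _).1 (H hv).2 p
  refine D.lowered_le ⟨D.w_mem_lowered, (Submodule.mem_iInf _).2 fun q => ?_⟩ ?_
  · simp [D.e_w]
  · rintro q v ⟨hv, hh⟩
    refine ⟨D.f_mem_lowered q hv, (Submodule.mem_iInf _).2 fun s => ?_⟩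
    rw [Submodule.mem_comap, D.e_f]
    exact add_mem (D.f_mem_lowered _ ((Submodule.mem_iInf _).1 hh s)) (D.h_mem_lowered _ hv)

lemma lowered_eq_top : D.lowered = ⊤ :=
  D.cyclic _ D.w_mem_lowered (fun p _ => D.e_mem_lowered p) (fun p _ => D.f_mem_lowered p)
    (fun p _ => D.h_mem_lowered p)

/-- A subspace containing the highest weight vector and stable under the lowering operators is
the whole space. -/
lemma eq_top_of_f_mem {X : Submodule ℂ M} (hw : D.w ∈ X) (hf : ∀ p, ∀ v ∈ X, D.f p v ∈ X) :
    X = ⊤ :=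
  top_le_iff.1 (D.lowered_eq_top ▸ D.lowered_le hw hf)

/-- An operator commuting with the lowering operators and killing the highest weight vector is
zero. -/
lemma eq_zero_of_commute {φ : Module.End ℂ M} (hw : φ D.w = 0)
    (hφ : ∀ p v, φ (D.f p v) = D.f p (φ v)) : φ = 0 := by
  refine LinearMap.ker_eq_top.1 (D.eq_top_of_f_mem (LinearMap.mem_ker.2 hw) fun p v hv => ?_)
  rw [LinearMap.mem_ker] at hv ⊢
  rw [hφ, hv, map_zero]

lemma f_T_pow (r : ℤ) : D.f (T r) ^ (n + 1) = 0 := by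
  refine D.eq_zero_of_commute (D.f_w r) fun p v => ?_
  have hc : Commute (D.f (T r)) (D.f p) := LinearMap.ext fun v => D.f_f _ _ v
  exact LinearMap.congr_fun (hc.pow_left (n + 1)).eq v

/-- `D.Leading k d v c`: the vector `v` is a combination of monomials of length `k` in the
operators `f (T r)`, `r : ℕ`, of total degree at most `d`, applied to the highest weight vector,
and the coefficients of the monomials of degree exactly `d` sum to `c`. -/
inductive Leading : ℕ → ℕ → M → ℂ → Prop
  | base : Leading 0 0 D.w 1
  | lower {k d d' : ℕ} {v : M} {c : ℂ} : d < d' → Leading k d v c → Leading k d' v 0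
  | add {k d : ℕ} {v v' : M} {c c' : ℂ} :
      Leading k d v c → Leading k d v' c' → Leading k d (v + v') (c + c')
  | smul {k d : ℕ} {v : M} {c : ℂ} (b : ℂ) : Leading k d v c → Leading k d (b • v) (b * c)
  | f {k d : ℕ} {v : M} {c : ℂ} (r : ℕ) :
      Leading k d v c → Leading (k + 1) (d + r) (D.f (T r) v) c

namespace Leading

variable {D}

lemma h {k d : ℕ} {v : M} {c : ℂ} (H : D.Leading k d v c) {s : ℕ} (hs : 0 < s) :
    D.Leading k (d + s) (D.h (T s) v) (-2 * k * c) := by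
  induction H with
  | base =>
    obtain ⟨b, hb⟩ := D.h_w (T s)
    rw [hb]
    convert Leading.smul b (Leading.lower (d' := 0 + s) (by lia) Leading.base) using 1
    simp
  | lower hd _ ih => simpa using Leading.lower (by lia) ih
  | add _ _ ih ih' =>
    rw [map_add]
    convert Leading.add ih ih' using 1
    ring
  | smul b _ ih =>
    rw [map_smul]
    convert Leading.smul b ih using 1
    ring
  | @f k d v c r H ih =>
    rw [D.h_f, sub_eq_add_neg, ← neg_smul, ← T_add]
    have h₁ := Leading.f r ih
    have h₂ := Leading.smul (-2) (Leading.f (s + r) H)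
    rw [add_right_comm] at h₁
    rw [show d + (s + r) = d + r + s by ring, Nat.cast_add] at h₂
    convert Leading.add h₁ h₂ using 1
    push_cast
    ring

lemma e_eq_zero {k d : ℕ} {v : M} {c : ℂ} (H : D.Leading k d v c) (hk : k = 0)
    (p : ℂ[T;T⁻¹]) : D.e p v = 0 := by
  induction H with
  | base => exact D.e_w p
  | lower _ _ ih => exact ih hk
  | add _ _ ih ih' => rw [map_add, ih hk, ih' hk, add_zero]
  | smul b _ ih => rw [map_smul, ih hk, smul_zero]
  | f r _ _ => lia

lemma e {k d : ℕ} {v : M} {c : ℂ} (H : D.Leading k d v c) {j : ℕ} (hk : k = j + 1) :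
    D.Leading j (d + 1) (D.e (T 1) v) (-(j + 1) * j * c) := by
  induction H generalizing j with
  | base => lia
  | lower hd _ ih => simpa using Leading.lower (by lia) (ih hk)
  | add _ _ ih ih' =>
    rw [map_add]
    convert Leading.add (ih hk) (ih' hk) using 1
    ring
  | smul b _ ih =>
    rw [map_smul]
    convert Leading.smul b (ih hk) using 1
    ring
  | @f k d v c r H ih =>
    obtain rfl : k = j := by lia
    rw [D.e_f, ← T_add]
    have h₁ := Leading.h H (s := 1 + r) (by lia)
    rw [show d + (1 + r) = d + r + 1 by ring, Nat.cast_add, Nat.cast_one] at h₁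
    cases k with
    | zero =>
      rw [H.e_eq_zero rfl, map_zero, zero_add]
      simpa using h₁
    | succ k =>
      have h₂ := Leading.f r (ih rfl)
      rw [add_right_comm] at h₂
      convert Leading.add h₂ h₁ using 1
      push_cast
      ring

lemma eq_smul {k d : ℕ} {v : M} {c : ℂ} (H : D.Leading k d v c) (hk : k = 0) :
    ∃ b : ℂ, v = b • D.w ∧ c = if d = 0 then b else 0 := by
  induction H with
  | base => exact ⟨1, by simp⟩
  | @lower k d d' v c hd _ ih =>
    obtain ⟨b, hb, -⟩ := ih hk
    exact ⟨b, hb, by rw [if_neg (by lia)]⟩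
  | add _ _ ih ih' =>
    obtain ⟨b, rfl, rfl⟩ := ih hk
    obtain ⟨b', rfl, rfl⟩ := ih' hk
    exact ⟨b + b', by rw [add_smul], by split_ifs <;> simp⟩
  | smul a _ ih =>
    obtain ⟨b, rfl, rfl⟩ := ih hk
    exact ⟨a * b, by rw [mul_smul], by split_ifs <;> simp⟩
  | f r _ _ => lia

lemma exists_polynomial {k d : ℕ} {v : M} {c : ℂ} (H : D.Leading k d v c) (hk : k = 1) :
    ∃ p : Polynomial ℂ, v = D.f (Polynomial.toLaurent p) D.w ∧ p.natDegree ≤ d ∧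
      p.coeff d = c := by
  induction H with
  | base => lia
  | @lower k d d' v c hd _ ih =>
    obtain ⟨p, hp, hpd, -⟩ := ih hk
    exact ⟨p, hp, by lia, Polynomial.coeff_eq_zero_of_natDegree_lt (by lia)⟩
  | add _ _ ih ih' =>
    obtain ⟨p, rfl, hp, rfl⟩ := ih hk
    obtain ⟨p', rfl, hp', rfl⟩ := ih' hk
    exact ⟨p + p', by simp, Polynomial.natDegree_add_le_of_degree_le hp hp', by simp⟩
  | smul a _ ih =>
    obtain ⟨p, rfl, hp, rfl⟩ := ih hk
    refine ⟨a • p, ?_, (Polynomial.natDegree_smul_le a p).trans hp, by simp⟩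
    rw [Polynomial.smul_eq_C_mul, map_mul, Polynomial.toLaurent_C, ← LaurentPolynomial.smul_eq_C_mul,
      map_smul, LinearMap.smul_apply]
  | @f k d v c r H ih =>
    obtain ⟨b, rfl, rfl⟩ := H.eq_smul (by lia)
    refine ⟨Polynomial.C b * Polynomial.X ^ r, ?_, ?_, ?_⟩
    · rw [Polynomial.toLaurent_C_mul_X_pow, ← LaurentPolynomial.smul_eq_C_mul, map_smul, map_smul,
        LinearMap.smul_apply]
    · exact (Polynomial.natDegree_C_mul_X_pow_le b r).trans (by lia)
    · rw [Polynomial.coeff_C_mul_X_pow]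
      congr 1
      simp

lemma f_zero_pow (m : ℕ) : D.Leading m 0 ((D.f (T 0) ^ m) D.w) 1 := by
  induction m with
  | zero => exact Leading.base
  | succ m ih =>
    rw [pow_succ', Module.End.mul_apply]
    exact Leading.f 0 ih

end Leading

lemma exists_leading_zero (i j : ℕ) (hij : i + j = n) :
    ∃ c : ℂ, c ≠ 0 ∧ D.Leading (j + 1) i 0 c := by
  induction i generalizing j with
  | zero =>
    have := Leading.f_zero_pow (D := D) (n + 1)
    rw [D.f_w] at this
    exact ⟨1, one_ne_zero, by convert this using 1; lia⟩
  | succ i ih =>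
    obtain ⟨c, hc, H⟩ := ih (j + 1) (by lia)
    have := H.e rfl
    rw [map_zero] at this
    refine ⟨_, ?_, this⟩
    have h₁ : ((j : ℂ) + 1) ≠ 0 := by exact_mod_cast j.succ_ne_zero
    have h₂ : ((j : ℂ) + 1 + 1) ≠ 0 := by exact_mod_cast (j + 1).succ_ne_zero
    push_cast
    exact mul_ne_zero (mul_ne_zero (neg_ne_zero.2 h₂) h₁) hc

/-- The lowering operators satisfy a nontrivial linear recurrence. -/
lemma exists_f_mul_eq_zero :
    ∃ p : Polynomial ℂ, p ≠ 0 ∧ ∀ q, D.f (q * Polynomial.toLaurent p) = 0 := by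
  obtain ⟨c, hc, H⟩ := D.exists_leading_zero n 0 (add_zero n)
  obtain ⟨p, hp, -, rfl⟩ := H.exists_polynomial (zero_add 1)
  refine ⟨p, fun h => hc (by simp [h]), fun q => D.eq_zero_of_commute ?_ fun p v => D.f_f _ _ v⟩
  obtain ⟨b, hb⟩ := D.h_w q
  have := D.h_f q (Polynomial.toLaurent p) D.w
  rw [← hp, hb, map_smul, ← hp, smul_zero, map_zero, zero_sub, zero_eq_neg] at this
  exact (smul_eq_zero.1 this).resolve_left two_ne_zero

end LoopHighestWeight

lemma LaurentPolynomial.finite_quotient_span_toLaurent {K : Type*} [Field K]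
    {p : Polynomial K} (hp : p ≠ 0) :
    Module.Finite K (K[T;T⁻¹] ⧸ Ideal.span {Polynomial.toLaurent p}) := by
  set I : Ideal K[T;T⁻¹] := Ideal.span {Polynomial.toLaurent p} with hI
  let π : K[T;T⁻¹] →ₐ[K] K[T;T⁻¹] ⧸ I := Ideal.Quotient.mkₐ K I
  have hT : IsAlgebraic K (π (T 1)) := by
    refine ⟨p, hp, ?_⟩
    rw [Polynomial.aeval_algHom_apply]
    have : Polynomial.aeval (T 1 : K[T;T⁻¹]) p = Polynomial.toLaurent p := by
      rw [← Polynomial.toLaurentAlg_apply, ← Polynomial.toLaurent_X, ← Polynomial.toLaurentAlg_apply,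
        Polynomial.aeval_algHom_apply, Polynomial.aeval_X_left_apply]
    rw [this]
    exact Ideal.Quotient.eq_zero_iff_mem.2 (Ideal.mem_span_singleton_self _)
  have hmul : π (T (-1)) * π (T 1) = 1 := by
    rw [← map_mul, ← T_add]; simp
  have hmul' : π (T 1) * π (T (-1)) = 1 := by rw [mul_comm, hmul]
  let : Invertible (π (T 1)) := ⟨π (T (-1)), hmul, hmul'⟩
  have hT' : IsAlgebraic K (π (T (-1))) := hT.invOf
  have key : ∀ x, IsIntegral K (π x) := by
    intro x
    induction x using LaurentPolynomial.induction_on' with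
    | add p q hp hq => rw [map_add]; exact hp.add hq
    | C_mul_T r a =>
      rw [← LaurentPolynomial.smul_eq_C_mul, map_smul]
      refine IsIntegral.smul a ?_
      obtain ⟨m, rfl | rfl⟩ := r.eq_nat_or_neg
      · rw [← mul_one (m : ℤ), ← T_pow, map_pow]
        exact hT.isIntegral.pow m
      · rw [← mul_neg_one (m : ℤ), ← T_pow, map_pow]
        exact hT'.isIntegral.pow m
  have hπ : Function.Surjective π := Ideal.Quotient.mkₐ_surjective K I
  have : Algebra.IsIntegral K (K[T;T⁻¹] ⧸ I) :=
    ⟨fun y => by obtain ⟨x, rfl⟩ := hπ y; exact key x⟩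
  have : Algebra.FiniteType K K[T;T⁻¹] := inferInstance
  have : Algebra.FiniteType K (K[T;T⁻¹] ⧸ I) := Algebra.FiniteType.of_surjective π hπ
  exact Algebra.IsIntegral.finite

namespace LoopHighestWeight

variable {M : Type*} [AddCommGroup M] [Module ℂ M] {n : ℕ} (D : LoopHighestWeight M n)

lemma span_f_T : Submodule.span ℂ (Set.range fun r : ℤ => D.f (T r)) = LinearMap.range D.f := by
  refine le_antisymm (Submodule.span_le.2 ?_) ?_
  · rintro _ ⟨r, rfl⟩
    exact ⟨_, rfl⟩
  · rintro _ ⟨q, rfl⟩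
    induction q using LaurentPolynomial.induction_on' with
    | add p q hp hq => rw [map_add]; exact add_mem hp hq
    | C_mul_T r a =>
      rw [← LaurentPolynomial.smul_eq_C_mul, map_smul]
      exact Submodule.smul_mem _ _ (Submodule.subset_span ⟨r, rfl⟩)

lemma exists_finset_span :
    ∃ R : Finset ℤ, ∀ p, D.f p ∈ Submodule.span ℂ ((fun r : ℤ => D.f (T r)) '' R) := by
  obtain ⟨p, hp, H⟩ := D.exists_f_mul_eq_zero
  have := LaurentPolynomial.finite_quotient_span_toLaurent hp
  let J := (Ideal.span {Polynomial.toLaurent p} : Ideal ℂ[T;T⁻¹]).restrictScalars ℂ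
  have : Module.Finite ℂ (ℂ[T;T⁻¹] ⧸ J) := this
  have hJ : J ≤ LinearMap.ker D.f := by
    intro q hq
    obtain ⟨q, rfl⟩ := Ideal.mem_span_singleton'.1 hq
    exact H q
  have hfg : (LinearMap.range D.f).FG := by
    rw [← Submodule.range_liftQ J D.f hJ]
    exact (Module.Finite.iff_fg).1 inferInstance
  rw [← D.span_f_T, Submodule.fg_span_iff_fg_span_finset_subset] at hfg
  obtain ⟨S, hS, hspan⟩ := hfg
  rw [← Set.image_univ] at hS
  classical
  obtain ⟨R, -, rfl⟩ := Finset.subset_set_image_iff.1 hS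
  refine ⟨R, fun q => ?_⟩
  rw [← Finset.coe_image, ← hspan, D.span_f_T]
  exact ⟨q, rfl⟩

lemma exists_finite_stable (R : Finset ℤ) :
    ∃ X : Submodule ℂ M, X.FG ∧ D.w ∈ X ∧ ∀ r ∈ R, ∀ v ∈ X, D.f (T r) v ∈ X := by
  induction R using Finset.induction_on with
  | empty => exact ⟨_, Submodule.fg_span_singleton D.w, Submodule.mem_span_singleton_self _, by simp⟩
  | insert r R _ ih =>
    obtain ⟨X, hX, hw, hR⟩ := ih
    let Y : Submodule ℂ M := ⨆ i ∈ Finset.range (n + 1), X.map (D.f (T r) ^ i)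
    have hmem : ∀ i < n + 1, ∀ v ∈ X, (D.f (T r) ^ i) v ∈ Y := fun i hi v hv =>
      Submodule.mem_iSup_of_mem i (Submodule.mem_iSup_of_mem (Finset.mem_range.2 hi)
        (Submodule.mem_map_of_mem hv))
    refine ⟨Y, Submodule.fg_biSup _ _ fun i _ => hX.map _, hmem 0 (by lia) _ hw, ?_⟩
    intro s hs
    suffices Y ≤ Y.comap (D.f (T s)) from fun v hv => this hv
    refine iSup₂_le fun i hi => ?_
    rintro _ ⟨v, hv, rfl⟩
    rw [Submodule.mem_comap]
    rw [Finset.mem_range] at hi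
    rcases Finset.mem_insert.1 hs with rfl | hs
    · rw [← Module.End.mul_apply, ← pow_succ']
      rcases Nat.lt_or_ge (i + 1) (n + 1) with h | h
      · exact hmem _ h v hv
      · rw [show i + 1 = n + 1 by lia, D.f_T_pow]
        exact Y.zero_mem
    · have hc : Commute (D.f (T s)) (D.f (T r)) := LinearMap.ext fun v => D.f_f _ _ v
      rw [← Module.End.mul_apply, (hc.pow_right i).eq]
      exact hmem i hi _ (hR s hs v hv)

/-- A highest weight representation of the loop algebra of `sl₂` on which the lowering operators
act nilpotently on the cyclic vector is finite-dimensional. -/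
theorem finite {M : Type*} [AddCommGroup M] [Module ℂ M] {n : ℕ} (D : LoopHighestWeight M n) :
    Module.Finite ℂ M := by
  obtain ⟨R, hR⟩ := D.exists_finset_span
  obtain ⟨X, hX, hw, hXR⟩ := D.exists_finite_stable R
  suffices X = ⊤ from ⟨this ▸ hX⟩
  refine D.eq_top_of_f_mem hw fun p v hv => ?_
  have : Submodule.span ℂ ((fun r : ℤ => D.f (T r)) '' R) ≤ X.comap (LinearMap.applyₗ v) := by
    rw [Submodule.span_le]
    rintro _ ⟨r, hr, rfl⟩
    exact hXR r hr v hv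
  exact this (hR p)

end LoopHighestWeight

section WeylModule

attribute [local instance] LieRing.ofAssociativeRing

/-- The action of `p ⊗ x` on the Weyl module, as a function of `p`. -/
noncomputable def weylAction (lam : ℕ) (a : Fin lam → ℂ) (x : sl (Fin 2) ℂ) :
    ℂ[T;T⁻¹] →ₗ[ℂ] Module.End ℂ (Ug ⧸ weylIdeal lam a) :=
  (Algebra.lsmul ℂ ℂ (Ug ⧸ weylIdeal lam a)).toLinearMap ∘ₗ
    (UniversalEnvelopingAlgebra.ι ℂ : loopSl2 →ₗ⁅ℂ⁆ Ug).toLinearMap ∘ₗ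
      (TensorProduct.mk ℂ ℂ[T;T⁻¹] (sl (Fin 2) ℂ)).flip x

lemma weylAction_apply (lam : ℕ) (a : Fin lam → ℂ) (x : sl (Fin 2) ℂ) (p : ℂ[T;T⁻¹])
    (v : Ug ⧸ weylIdeal lam a) :
    weylAction lam a x p v = (UniversalEnvelopingAlgebra.ι ℂ (p ⊗ₜ[ℂ] x) : Ug) • v :=
  rfl

lemma weylAction_pow_apply (lam : ℕ) (a : Fin lam → ℂ) (x : sl (Fin 2) ℂ) (p : ℂ[T;T⁻¹]) (k : ℕ)
    (v : Ug ⧸ weylIdeal lam a) :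
    (weylAction lam a x p ^ k) v = (UniversalEnvelopingAlgebra.ι ℂ (p ⊗ₜ[ℂ] x) : Ug) ^ k • v := by
  induction k with
  | zero => simp
  | succ k ih => rw [pow_succ', pow_succ', Module.End.mul_apply, ih, weylAction_apply, mul_smul]

lemma weylAction_add (lam : ℕ) (a : Fin lam → ℂ) (x y : sl (Fin 2) ℂ) :
    weylAction lam a (x + y) = weylAction lam a x + weylAction lam a y := by
  simp only [weylAction, map_add, LinearMap.comp_add]

lemma weylAction_smul (lam : ℕ) (a : Fin lam → ℂ) (c : ℂ) (x : sl (Fin 2) ℂ) :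
    weylAction lam a (c • x) = c • weylAction lam a x := by
  simp only [weylAction, map_smul, LinearMap.comp_smul]

lemma weylAction_comm (lam : ℕ) (a : Fin lam → ℂ) (x y : sl (Fin 2) ℂ) (p q : ℂ[T;T⁻¹])
    (v : Ug ⧸ weylIdeal lam a) :
    weylAction lam a x p (weylAction lam a y q v) =
      weylAction lam a y q (weylAction lam a x p v) + weylAction lam a ⁅x, y⁆ (p * q) v := by
  simp only [weylAction_apply]
  rw [← LieAlgebra.ExtendScalars.bracket_tmul, LieHom.map_lie, LieRing.of_associative_ring_bracket,
    sub_smul, mul_smul, mul_smul, add_sub_cancel]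

lemma lie_Esl2_Fsl2 : ⁅Esl2, Fsl2⁆ = Hsl2 := by
  apply Subtype.ext
  ext i j
  fin_cases i <;> fin_cases j <;> simp [Esl2, Fsl2, Hsl2, Ring.lie_def]

lemma lie_Hsl2_Fsl2 : ⁅Hsl2, Fsl2⁆ = (-2 : ℂ) • Fsl2 := by
  apply Subtype.ext
  ext i j
  fin_cases i <;> fin_cases j <;> simp [Fsl2, Hsl2, Ring.lie_def]
  norm_num

lemma eq_add_Esl2_Fsl2_Hsl2 (x : sl (Fin 2) ℂ) :
    x = x.1 0 1 • Esl2 + x.1 1 0 • Fsl2 + x.1 0 0 • Hsl2 := by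
  have hx : x.1 0 0 + x.1 1 1 = 0 := by
    rw [← Matrix.trace_fin_two]
    exact x.2
  apply Subtype.ext
  ext i j
  fin_cases i <;> fin_cases j <;> simp [Esl2, Fsl2, Hsl2]
  exact eq_neg_of_add_eq_zero_right hx

/-- A submodule containing all powers of `T` contains every Laurent polynomial. -/
lemma LaurentPolynomial.mem_of_T_mem {K : Type*} [CommSemiring K] {X : Submodule K K[T;T⁻¹]}
    (hX : ∀ r : ℤ, T r ∈ X) (p : K[T;T⁻¹]) : p ∈ X := by
  induction p using LaurentPolynomial.induction_on' with
  | add p q hp hq => exact add_mem hp hq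
  | C_mul_T r a =>
    rw [← LaurentPolynomial.smul_eq_C_mul]
    exact X.smul_mem a (hX r)

lemma UniversalEnvelopingAlgebra.adjoin_range_ι {R L : Type*} [CommRing R] [LieRing L]
    [LieAlgebra R L] :
    Algebra.adjoin R (Set.range (UniversalEnvelopingAlgebra.ι R : L → _)) = ⊤ := by
  set S := Algebra.adjoin R (Set.range (UniversalEnvelopingAlgebra.ι R : L → _))
  let g : L →ₗ⁅R⁆ S :=
    { toFun := fun x => ⟨UniversalEnvelopingAlgebra.ι R x, Algebra.subset_adjoin ⟨x, rfl⟩⟩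
      map_add' := fun x y => Subtype.ext (by simp)
      map_smul' := fun c x => Subtype.ext (by simp)
      map_lie' := fun {x y} => Subtype.ext (by simp [LieRing.of_associative_ring_bracket]) }
  have hg : S.val.comp (UniversalEnvelopingAlgebra.lift R g) = AlgHom.id R _ := by
    ext x
    simp [g]
  refine top_le_iff.1 fun u _ => ?_
  have hu : (UniversalEnvelopingAlgebra.lift R g u : UniversalEnvelopingAlgebra R L) = u :=
    AlgHom.congr_fun hg u
  rw [← hu]
  exact (UniversalEnvelopingAlgebra.lift R g u).2

/-- The Weyl module is a highest weight representation of the loop algebra. -/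
noncomputable def weylHighestWeight (lam : ℕ) (a : Fin lam → ℂ) :
    LoopHighestWeight (Ug ⧸ weylIdeal lam a) lam where
  e := weylAction lam a Esl2
  f := weylAction lam a Fsl2
  h := weylAction lam a Hsl2
  w := (weylIdeal lam a).mkQ 1
  e_f p q v := by rw [weylAction_comm, lie_Esl2_Fsl2]
  h_f p q v := by
    rw [weylAction_comm, lie_Hsl2_Fsl2, weylAction_smul, sub_eq_add_neg, ← neg_smul,
      LinearMap.smul_apply, LinearMap.smul_apply]
  f_f p q v := by
    rw [weylAction_comm, lie_self, mul_comm, add_eq_left, weylAction_apply, TensorProduct.tmul_zero,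
      map_zero, zero_smul]
  e_w p := by
    refine LaurentPolynomial.mem_of_T_mem
      (X := LinearMap.ker ((weylAction lam a Esl2).flip ((weylIdeal lam a).mkQ 1))) (fun r => ?_) p
    rw [LinearMap.mem_ker, LinearMap.flip_apply, weylAction_apply, ← map_smul, smul_eq_mul, mul_one,
      Submodule.mkQ_apply, Submodule.Quotient.mk_eq_zero]
    exact Ideal.subset_span (.inl (.inl ⟨r, rfl⟩))
  h_w p := by
    suffices H : weylAction lam a Hsl2 p ((weylIdeal lam a).mkQ 1) ∈
        Submodule.span ℂ {(weylIdeal lam a).mkQ 1} by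
      obtain ⟨c, hc⟩ := Submodule.mem_span_singleton.1 H
      exact ⟨c, hc.symm⟩
    refine LaurentPolynomial.mem_of_T_mem
      (X := (Submodule.span ℂ {(weylIdeal lam a).mkQ 1}).comap
        ((weylAction lam a Hsl2).flip ((weylIdeal lam a).mkQ 1))) (fun r => ?_) p
    rw [Submodule.mem_comap, LinearMap.flip_apply, weylAction_apply, ← map_smul, smul_eq_mul,
      mul_one, Submodule.mem_span_singleton]
    refine ⟨∑ j, a j ^ r, ?_⟩
    rw [← algebraMap_smul Ug, ← map_smul, smul_eq_mul, mul_one]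
    refine ((Submodule.Quotient.eq _).2 ?_).symm
    exact Ideal.subset_span (.inl (.inr ⟨r, rfl⟩))
  f_w r := by
    rw [weylAction_pow_apply, ← map_smul, smul_eq_mul, mul_one, Submodule.mkQ_apply,
      Submodule.Quotient.mk_eq_zero]
    exact Ideal.subset_span (.inr ⟨r, rfl⟩)
  cyclic X hw he hf hh := by
    have hι : ∀ y : loopSl2, ∀ v ∈ X, (UniversalEnvelopingAlgebra.ι ℂ y : Ug) • v ∈ X := by
      intro y v hv
      induction y using TensorProduct.induction_on with
      | zero => rw [map_zero, zero_smul]; exact X.zero_mem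
      | add y z hy hz => rw [map_add, add_smul]; exact add_mem hy hz
      | tmul p x =>
        rw [← weylAction_apply, eq_add_Esl2_Fsl2_Hsl2 x]
        simp only [weylAction_add, weylAction_smul, LinearMap.add_apply, LinearMap.smul_apply]
        exact add_mem (add_mem (X.smul_mem _ (he p v hv)) (X.smul_mem _ (hf p v hv)))
          (X.smul_mem _ (hh p v hv))
    have hU : ∀ u : Ug, ∀ v ∈ X, u • v ∈ X := by
      intro u
      have hu : u ∈ Algebra.adjoin ℂ (Set.range (UniversalEnvelopingAlgebra.ι ℂ : loopSl2 → Ug)) := by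
        rw [UniversalEnvelopingAlgebra.adjoin_range_ι]
        exact Algebra.mem_top
      induction hu using Algebra.adjoin_induction with
      | mem u hu => obtain ⟨y, rfl⟩ := hu; exact hι y
      | algebraMap c => intro v hv; rw [algebraMap_smul]; exact X.smul_mem c hv
      | add x y _ _ hx hy => intro v hv; rw [add_smul]; exact add_mem (hx v hv) (hy v hv)
      | mul x y _ _ hx hy => intro v hv; rw [mul_smul]; exact hx _ (hy v hv)
    refine top_le_iff.1 fun v _ => ?_
    obtain ⟨u, rfl⟩ := (weylIdeal lam a).mkQ_surjective v
    have := hU u _ hw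
    rwa [← map_smul, smul_eq_mul, mul_one] at this

end WeylModule

/-- The Weyl module `W(ω) = U(g̃)/I` is finite-dimensional over `ℂ`. -/
theorem weyl_module_finiteDimensional (lam : ℕ) (a : Fin lam → ℂ)
    (ha : ∀ j, a j ≠ 0) :
    FiniteDimensional ℂ (Ug ⧸ weylIdeal lam a) := by
  exact (weylHighestWeight lam a).finite
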